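/- arXiv:1710.07040 — 4 statements merged into one kernel-verified Lean document; each statement's English description precedes it below -/
import Mathlib

section
/- Every dual feasible solution lower-bounds the GW-value of every tree containing the root: let (G, w, p, r) be a PCST instance and let y be a dual feasible solution. Then for every subtree T = (V', E') of G containing r, Σ_{S} y_S ≤ Σ_{e ∈ E'} w_e + Σ_{v ∈ V∖V'} p_v, where the sum on the left ranges over nonempty subsets S ⊆ V \ {r}. -/
open Finset
open scoped Classical

variable {V : Type*} [Fintype V] [DecidableEq V]

/-- An edge `e` crosses the vertex set `S` if exactly one of its endpoints lies in `S`. -/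
def crosses (S : Finset V) (e : Sym2 V) : Prop :=
  ∃ u v, e = s(u, v) ∧ u ∈ S ∧ v ∉ S

/-- The index set of the dual LP variables: nonempty subsets of `V \ {r}`. -/
def dualSets (r : V) : Finset (Finset V) :=
  (Finset.univ.erase r).powerset.filter Finset.Nonempty

/-- Dual feasibility for the PCST LP relaxation: nonnegativity, edge packing
constraints, and penalty packing constraints. -/
def DualFeasible (G : SimpleGraph V) (w : Sym2 V → ℝ) (p : V → ℝ) (r : V)
    (y : Finset V → ℝ) : Prop :=
  (∀ S ∈ dualSets r, 0 ≤ y S) ∧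
  (∀ e ∈ G.edgeSet, ∑ S ∈ (dualSets r).filter (fun S => crosses S e), y S ≤ w e) ∧
  (∀ U ∈ dualSets r, ∑ S ∈ (dualSets r).filter (fun S => S ⊆ U), y S ≤ ∑ v ∈ U, p v)

/-- Primal feasibility for the PCST LP relaxation. -/
def PrimalFeasible (G : SimpleGraph V) [DecidableRel G.Adj] (r : V)
    (x : Sym2 V → ℝ) (z : Finset V → ℝ) : Prop :=
  (∀ e ∈ G.edgeSet, 0 ≤ x e) ∧
  (∀ U ∈ dualSets r, 0 ≤ z U) ∧
  (∀ S ∈ dualSets r,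
      1 ≤ ∑ e ∈ G.edgeFinset.filter (fun e => crosses S e), x e +
          ∑ U ∈ (dualSets r).filter (fun U => S ⊆ U), z U)

/-- `(V', E')` is a subtree of `G` containing the root `r`: its edges are edges of `G`
with both endpoints in `V'`, it is connected, and it is acyclic. -/
def IsRootedSubtree (G : SimpleGraph V) (r : V) (V' : Finset V)
    (E' : Finset (Sym2 V)) : Prop :=
  r ∈ V' ∧
  (∀ e ∈ E', e ∈ G.edgeSet) ∧
  (∀ e ∈ E', ∀ u ∈ e, u ∈ V') ∧
  (∀ u ∈ V', ∀ v ∈ V', (SimpleGraph.fromEdgeSet (E' : Set (Sym2 V))).Reachable u v) ∧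
  (SimpleGraph.fromEdgeSet (E' : Set (Sym2 V))).IsAcyclic

/-- A connected edge set joining a vertex of `S` to a vertex outside `S` has an edge crossing `S`. -/
theorem exists_crosses_of_reachable {W : Type*} {E : Set (Sym2 W)} {S : Finset W} {u v : W}
    (h : (SimpleGraph.fromEdgeSet E).Reachable u v) (hu : u ∈ S) (hv : v ∉ S) :
    ∃ e ∈ E, crosses S e := by
  obtain ⟨q⟩ := h
  obtain ⟨d, -, hfst, hsnd⟩ := q.exists_boundary_dart (S : Set W) hu hv
  exact ⟨s(d.fst, d.snd), ((SimpleGraph.fromEdgeSet_adj E).1 d.adj).1, d.fst, d.snd, rfl,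
    hfst, hsnd⟩

/-- **Every dual feasible solution lower-bounds the GW-value of every subtree containing
the root.** -/
theorem dual_le_GW_of_rootedSubtree
    (G : SimpleGraph V) [DecidableRel G.Adj]
    (w : Sym2 V → ℝ) (p : V → ℝ) (r : V)
    (hG : G.Connected)
    (hw : ∀ e ∈ G.edgeSet, 0 ≤ w e) (hp : ∀ v, 0 ≤ p v)
    (y : Finset V → ℝ) (hy : DualFeasible G w p r y)
    (V' : Finset V) (E' : Finset (Sym2 V))
    (hT : IsRootedSubtree G r V' E') :
    ∑ S ∈ dualSets r, y S ≤
      ∑ e ∈ E', w e + ∑ v ∈ Finset.univ \ V', p v := by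
  obtain ⟨hr, hE, -, hconn, -⟩ := hT
  obtain ⟨hy0, hedge, hpen⟩ := hy
  have hout : ∑ S ∈ dualSets r with S ⊆ univ \ V', y S ≤ ∑ v ∈ univ \ V', p v := by
    by_cases hne : (univ \ V').Nonempty
    · refine hpen _ (mem_filter.2 ⟨mem_powerset.2 fun v hv => ?_, hne⟩)
      rw [mem_sdiff] at hv
      exact mem_erase.2 ⟨fun h => hv.2 (h ▸ hr), mem_univ v⟩
    · rw [not_nonempty_iff_eq_empty] at hne
      rw [hne, sum_empty]
      refine (sum_eq_zero fun S hS => ?_).le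
      obtain ⟨hS, hsub⟩ := mem_filter.1 hS
      exact absurd (subset_empty.1 hsub) (mem_filter.1 hS).2.ne_empty
  have hin : ∑ S ∈ dualSets r with ¬ S ⊆ univ \ V', y S ≤ ∑ e ∈ E', w e := by
    have hcross : ∀ S ∈ (dualSets r).filter (fun S => ¬ S ⊆ univ \ V'),
        y S ≤ ∑ e ∈ E', if crosses S e then y S else 0 := by
      intro S hS
      obtain ⟨hS, hsub⟩ := mem_filter.1 hS
      obtain ⟨u, huS, hu⟩ := not_subset.1 hsub
      have huV : u ∈ V' := by simpa using hu
      have hrS : r ∉ S := fun h =>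
        (mem_erase.1 (mem_powerset.1 (mem_filter.1 hS).1 h)).1 rfl
      obtain ⟨e, he, hc⟩ := exists_crosses_of_reachable (hconn u huV r hr) huS hrS
      calc y S = if crosses S e then y S else 0 := (if_pos hc).symm
        _ ≤ ∑ e ∈ E', if crosses S e then y S else 0 :=
          single_le_sum (f := fun e => if crosses S e then y S else 0)
            (fun e _ => by split_ifs <;> [exact hy0 S hS; exact le_rfl]) he
    calc ∑ S ∈ dualSets r with ¬ S ⊆ univ \ V', y S
        ≤ ∑ S ∈ dualSets r with ¬ S ⊆ univ \ V', ∑ e ∈ E', (if crosses S e then y S else 0) :=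
          sum_le_sum hcross
      _ ≤ ∑ S ∈ dualSets r, ∑ e ∈ E', (if crosses S e then y S else 0) :=
          sum_le_sum_of_subset_of_nonneg (filter_subset _ _) fun S hS _ =>
            sum_nonneg fun e _ => by split_ifs <;> [exact hy0 S hS; exact le_rfl]
      _ = ∑ e ∈ E', ∑ S ∈ dualSets r with crosses S e, y S := by
          rw [sum_comm]
          exact sum_congr rfl fun e _ => (sum_filter _ _).symm
      _ ≤ ∑ e ∈ E', w e := sum_le_sum fun e he => hedge e (hE e he)
  rw [← sum_filter_add_sum_filter_not (dualSets r) (fun S => S ⊆ univ \ V')]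
  linarith
end

section
/- Forest degree-counting lemma (core of the approximation analysis): let H be a finite simple graph that is acyclic and has at least one edge, whose vertex set is partitioned into two sets N_A and N_I. Suppose every vertex of N_I has degree at least 1, and at most one vertex of N_I has degree exactly 1 (every other vertex of N_I has degree at least 2). Then Σ_{v ∈ N_A, deg(v) ≥ 1} deg(v) ≤ 2·|{v ∈ N_A : deg(v) ≥ 1}| − 1. -/
open Finset
open scoped Classical

/-- A forest on a nonempty finite vertex type has fewer edges than vertices. -/
lemma SimpleGraph.IsAcyclic.card_edgeFinset_add_one_le {V : Type*} [Fintype V] [Nonempty V]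
    {G : SimpleGraph V} [DecidableRel G.Adj] (h : G.IsAcyclic) :
    G.edgeFinset.card + 1 ≤ Fintype.card V := by
  obtain ⟨T, hGT, -, hT⟩ :=
    SimpleGraph.connected_top.exists_isTree_le_of_le_of_isAcyclic le_top h
  rw [← hT.card_edgeFinset]
  gcongr

/-- A forest with at least one edge has fewer edges than non-isolated vertices. -/
lemma SimpleGraph.IsAcyclic.card_edgeFinset_add_one_le_card_filter_degree
    {V : Type*} [Fintype V] {G : SimpleGraph V} [DecidableRel G.Adj] (h : G.IsAcyclic)
    (hedge : G.edgeFinset.Nonempty) :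
    G.edgeFinset.card + 1 ≤ (univ.filter fun v => 1 ≤ G.degree v).card := by
  obtain ⟨e, he⟩ := hedge
  induction e with
  | h a b =>
    have hab : G.Adj a b := by simpa using he
    have : Nonempty G.support := ⟨⟨a, b, hab⟩⟩
    have hcard := (h.induce G.support).card_edgeFinset_add_one_le
    rw [SimpleGraph.card_edgeFinset_induce_support] at hcard
    refine hcard.trans_eq (Fintype.card_of_subtype _ fun v => ?_)
    rw [mem_filter_univ, Nat.one_le_iff_ne_zero, ← Nat.pos_iff_ne_zero,
      G.degree_pos_iff_exists_adj, SimpleGraph.mem_support]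

/-- A sum of positive natural numbers at most one of which equals `1` is at least twice the number
of summands minus one. -/
lemma Finset.two_mul_card_le_sum_add_one {ι : Type*} (s : Finset ι) (f : ι → ℕ)
    (hpos : ∀ i ∈ s, 1 ≤ f i) (hone : ∀ i ∈ s, ∀ j ∈ s, f i = 1 → f j = 1 → i = j) :
    2 * s.card ≤ ∑ i ∈ s, f i + 1 := by
  have hle : (s.filter fun i => f i = 1).card ≤ 1 := by
    rw [card_le_one]
    simp only [mem_filter]
    exact fun i hi j hj => hone i hi.1 j hj.1 hi.2 hj.2
  calc 2 * s.card = ∑ i ∈ s, 2 := by rw [sum_const, smul_eq_mul, mul_comm]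
    _ ≤ ∑ i ∈ s, (f i + if f i = 1 then 1 else 0) := by
      refine sum_le_sum fun i hi => ?_
      have := hpos i hi
      split_ifs <;> omega
    _ = ∑ i ∈ s, f i + (s.filter fun i => f i = 1).card := by
      rw [sum_add_distrib, card_filter]
    _ ≤ ∑ i ∈ s, f i + 1 := by gcongr

/-- **Forest degree-counting lemma.** Let `H` be a finite acyclic simple graph with at
least one edge whose vertex set is partitioned into `NA` and `NI`, where every vertex of
`NI` has degree at least `1` and at most one vertex of `NI` has degree exactly `1`. Then
the sum of the degrees of the vertices of `NA` of positive degree is at most twice their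
number minus one. -/
theorem forest_degree_count
    {W : Type*} [Fintype W] [DecidableEq W]
    (H : SimpleGraph W) [DecidableRel H.Adj]
    (hacyclic : H.IsAcyclic)
    (hedge : H.edgeFinset.Nonempty)
    (NA NI : Finset W)
    (hdisj : Disjoint NA NI) (hcover : NA ∪ NI = Finset.univ)
    (hNI : ∀ v ∈ NI, 1 ≤ H.degree v)
    (hNIone : ∀ u ∈ NI, ∀ v ∈ NI, H.degree u = 1 → H.degree v = 1 → u = v) :
    ∑ v ∈ NA.filter (fun v => 1 ≤ H.degree v), (H.degree v : ℤ) ≤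
      2 * ((NA.filter (fun v => 1 ≤ H.degree v)).card : ℤ) - 1 := by
  have hforest := hacyclic.card_edgeFinset_add_one_le_card_filter_degree hedge
  have hsum := H.sum_degrees_eq_twice_card_edges
  rw [← hcover, sum_union hdisj] at hsum
  rw [← hcover, filter_union, filter_true_of_mem hNI,
    card_union_of_disjoint (hdisj.mono_left (filter_subset _ _))] at hforest
  have hNIsum := NI.two_mul_card_le_sum_add_one (fun v => H.degree v) hNI hNIone
  have hNAsum : ∑ v ∈ NA.filter (fun v => 1 ≤ H.degree v), H.degree v = ∑ v ∈ NA, H.degree v :=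
    sum_filter_of_ne fun v _ hv => Nat.one_le_iff_ne_zero.mpr hv
  rw [← Nat.cast_sum, hNAsum]
  omega
end

section
/- Per-increment inequality used in the inductive maintenance of the approximation bound: let H be a finite simple graph that is acyclic and has at least one edge, whose vertex set is partitioned into two sets N_A and N_I, such that every vertex of N_I has degree at least 1 and at most one vertex of N_I has degree exactly 1 (every other vertex of N_I has degree at least 2). Let N_D = {v ∈ N_A : deg(v) = 0}. If n ≥ 2 is an integer with |N_A \ N_D| ≤ n − 1 and ε ≥ 0 is a real number, then ε · Σ_{v ∈ N_A∖N_D} deg(v) + ε · |N_D| ≤ (2 − 1/(n−1)) · ε · |N_A|. -/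
open Finset
open scoped Classical

/-- A forest on a nonempty vertex set has fewer edges than vertices. -/
theorem SimpleGraph.IsAcyclic.card_edgeFinset_lt {V : Type*} [Fintype V] [Nonempty V]
    {G : SimpleGraph V} [Fintype G.edgeSet] (hG : G.IsAcyclic) :
    G.edgeFinset.card < Fintype.card V := by
  obtain ⟨T, hGT, -, hT⟩ :=
    (SimpleGraph.connected_top (V := V)).exists_isTree_le_of_le_of_isAcyclic le_top hG
  have hcard := hT.card_edgeFinset
  have hle : G.edgeFinset.card ≤ T.edgeFinset.card :=
    Finset.card_le_card (SimpleGraph.edgeFinset_mono hGT)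
  omega

/-- A forest with an edge has fewer edges than non-isolated vertices. -/
theorem SimpleGraph.IsAcyclic.card_edgeFinset_lt_card_degree_ne_zero {V : Type*} [Fintype V]
    {G : SimpleGraph V} [DecidableRel G.Adj] (hG : G.IsAcyclic) (hne : G.edgeFinset.Nonempty) :
    G.edgeFinset.card < (Finset.univ.filter fun v => G.degree v ≠ 0).card := by
  have hmem : ∀ v, v ∈ G.support ↔ G.degree v ≠ 0 := fun v => by
    rw [SimpleGraph.mem_support, ← Nat.pos_iff_ne_zero, SimpleGraph.degree_pos_iff_exists_adj]
  obtain ⟨e, he⟩ := hne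
  induction e with
  | h u v =>
    have huv : G.Adj u v := by simpa using he
    have : Nonempty G.support := ⟨⟨u, v, huv⟩⟩
    have h := (hG.induce G.support).card_edgeFinset_lt
    rw [SimpleGraph.card_edgeFinset_induce_support, Fintype.card_subtype] at h
    simpa only [hmem] using h

/-- If every vertex of `s` is non-isolated and at most one of them is a leaf, then the degrees
over `s` sum to at least `2 * #s - 1`. -/
theorem SimpleGraph.two_mul_card_le_sum_degree_add_one {V : Type*} [Fintype V]
    (G : SimpleGraph V) [DecidableRel G.Adj] (s : Finset V) (hpos : ∀ v ∈ s, 1 ≤ G.degree v)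
    (hone : ∀ u ∈ s, ∀ v ∈ s, G.degree u = 1 → G.degree v = 1 → u = v) :
    2 * s.card ≤ ∑ v ∈ s, G.degree v + 1 := by
  have hleaf : (s.filter fun v => G.degree v = 1).card ≤ 1 := by
    rw [Finset.card_le_one]
    intro u hu v hv
    rw [Finset.mem_filter] at hu hv
    exact hone u hu.1 v hv.1 hu.2 hv.2
  have hsum : ∑ _v ∈ s, 2 ≤ ∑ v ∈ s, (G.degree v + if G.degree v = 1 then 1 else 0) := by
    refine Finset.sum_le_sum fun v hv => ?_
    have := hpos v hv
    split_ifs <;> omega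
  rw [Finset.sum_add_distrib, ← Finset.card_filter, Finset.sum_const, smul_eq_mul] at hsum
  omega

/-- **Per-increment inequality** used in the inductive maintenance of the approximation
bound. With `H`, `NA`, `NI` as in the degree-counting lemma, `ND` the set of degree-zero
vertices of `NA`, `n ≥ 2` with `|NA \ ND| ≤ n - 1`, and `ε ≥ 0`:
`ε·∑_{v ∈ NA∖ND} deg v + ε·|ND| ≤ (2 - 1/(n-1))·ε·|NA|`. -/
theorem per_increment_inequality
    {W : Type*} [Fintype W] [DecidableEq W]
    (H : SimpleGraph W) [DecidableRel H.Adj]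
    (hacyclic : H.IsAcyclic)
    (hedge : H.edgeFinset.Nonempty)
    (NA NI : Finset W)
    (hdisj : Disjoint NA NI) (hcover : NA ∪ NI = Finset.univ)
    (hNI : ∀ v ∈ NI, 1 ≤ H.degree v)
    (hNIone : ∀ u ∈ NI, ∀ v ∈ NI, H.degree u = 1 → H.degree v = 1 → u = v)
    (ND : Finset W) (hND : ND = NA.filter (fun v => H.degree v = 0))
    (n : ℕ) (hn : 2 ≤ n) (hcard : (NA \ ND).card ≤ n - 1)
    (ε : ℝ) (hε : 0 ≤ ε) :
    ε * ∑ v ∈ NA \ ND, (H.degree v : ℝ) + ε * ND.card ≤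
      (2 - 1 / ((n : ℝ) - 1)) * ε * NA.card := by
  have hsplit : (univ.filter fun v => H.degree v ≠ 0) = (NA \ ND) ∪ NI := by
    ext v
    have hv : v ∈ NA ∪ NI := hcover ▸ mem_univ v
    have hpos := hNI v
    simp only [hND, mem_union, mem_sdiff, mem_filter, mem_univ, true_and] at hv ⊢
    grind
  have hdisj' : Disjoint (NA \ ND) NI := hdisj.mono_left sdiff_subset
  have hsub : ND ⊆ NA := hND ▸ filter_subset _ _
  have hforest := hacyclic.card_edgeFinset_lt_card_degree_ne_zero hedge
  rw [hsplit, card_union_of_disjoint hdisj'] at hforest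
  have htotal : ∑ v ∈ NA \ ND, H.degree v + ∑ v ∈ NI, H.degree v = 2 * H.edgeFinset.card := by
    rw [← sum_union hdisj', ← hsplit, sum_filter_ne_zero, H.sum_degrees_eq_twice_card_edges]
  have hleaf := H.two_mul_card_le_sum_degree_add_one NI hNI hNIone
  have hdeg : ∑ v ∈ NA \ ND, H.degree v + 1 ≤ 2 * (NA \ ND).card := by omega
  have hNA : (NA \ ND).card + ND.card = NA.card := card_sdiff_add_card_eq_card hsub
  have hdegR : ∑ v ∈ NA \ ND, (H.degree v : ℝ) + 1 ≤ 2 * ((NA \ ND).card : ℝ) := by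
    exact_mod_cast hdeg
  have hNAR : ((NA \ ND).card : ℝ) + ND.card = NA.card := by exact_mod_cast hNA
  have hn' : (1 : ℝ) ≤ (n : ℝ) - 1 := by
    have : (2 : ℝ) ≤ n := by exact_mod_cast hn
    linarith
  have hcardR : ((NA \ ND).card : ℝ) ≤ (n : ℝ) - 1 := by
    have : (NA \ ND).card + 1 ≤ n := by omega
    have : ((NA \ ND).card : ℝ) + 1 ≤ n := by exact_mod_cast this
    linarith
  have hactive : 1 / ((n : ℝ) - 1) * (NA \ ND).card ≤ 1 := by
    rw [one_div_mul_eq_div]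
    exact div_le_one_of_le₀ hcardR (by linarith)
  have hisolated : 1 / ((n : ℝ) - 1) * ND.card ≤ ND.card :=
    mul_le_of_le_one_left (Nat.cast_nonneg _) (div_le_one_of_le₀ hn' (by linarith))
  have key : ∑ v ∈ NA \ ND, (H.degree v : ℝ) + ND.card ≤
      (2 - 1 / ((n : ℝ) - 1)) * NA.card := by
    rw [← hNAR]
    linarith
  calc _ = ε * (∑ v ∈ NA \ ND, (H.degree v : ℝ) + ND.card) := by ring
    _ ≤ ε * ((2 - 1 / ((n : ℝ) - 1)) * NA.card) := mul_le_mul_of_nonneg_left key hε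
    _ = _ := by ring
end

section
/- Goemans–Williamson guarantee with dual certificate (main approximation theorem, existence form): for every PCST instance (G, w, p, r) with n = |V| ≥ 2, there exist a subtree T = (V', E') of G containing r and a dual feasible solution y such that Σ_{e ∈ E'} w_e + Σ_{v ∈ V∖V'} p_v ≤ (2 − 1/(n−1)) · Σ_S y_S, where the sum over S ranges over nonempty subsets of V \ {r}. -/
open Finset
open scoped Classical

variable {V : Type*} [Fintype V] [DecidableEq V]

set_option linter.unusedSectionVars false

/-- The cluster of vertices carrying the label `c` under the labelling `f`. -/
def cluster (f : V → V) (c : V) : Finset V :=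
  univ.filter fun x => f x = c

/-- Trees of clusters containing the cluster of `r`, grown one leaf at a time. Clusters are
represented by their labels under `f`, edges by edges of `G`. -/
inductive ClusterTree (G : SimpleGraph V) (f : V → V) (r : V) :
    Finset V → Finset (Sym2 V) → Prop
  | root : ClusterTree G f r {r} ∅
  | grow {T : Finset V} {F : Finset (Sym2 V)} {x y : V} : ClusterTree G f r T F →
      G.Adj x y → f x ∈ T → f y ∉ T → ClusterTree G f r (insert (f y) T) (insert s(x, y) F)

/-- The number of edges of `F` leaving the cluster labelled `c`. -/
noncomputable def clusterDegree (f : V → V) (F : Finset (Sym2 V)) (c : V) : ℕ :=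
  (F.filter fun e => crosses (cluster f c) e).card

/-- The number of clusters with label in `A` that the edge `e` leaves. -/
noncomputable def edgeLoad (f : V → V) (A : Finset V) (e : Sym2 V) : ℕ :=
  (A.filter fun c => crosses (cluster f c) e).card

/-- The non-root labels with positive residual prize. -/
noncomputable def activeLabels (r : V) (q : V → ℝ) : Finset V :=
  univ.filter fun c => c ≠ r ∧ 0 < q c

/-- A cluster tree and a dual solution constant on the clusters of `f` that witness the
approximation ratio `ρ` for edge weights `w` and cluster prizes `q`. -/
def HasCertificate (G : SimpleGraph V) (r : V) (ρ : ℝ) (f : V → V) (w : Sym2 V → ℝ)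
    (q : V → ℝ) : Prop :=
  ∃ (T : Finset V) (F : Finset (Sym2 V)) (y : Finset V → ℝ),
    ClusterTree G f r T F ∧ DualFeasible G w q r y ∧
    (∀ S ∈ dualSets r, y S ≠ 0 → ∀ a b, f a = f b → a ∈ S → b ∈ S) ∧
    ∑ e ∈ F, w e + ∑ c ∈ univ \ T, q c ≤ ρ * ∑ S ∈ dualSets r, y S

lemma mem_dualSets {r : V} {S : Finset V} : S ∈ dualSets r ↔ r ∉ S ∧ S.Nonempty := by
  simp [dualSets, subset_erase]

lemma mem_cluster {f : V → V} {c x : V} : x ∈ cluster f c ↔ f x = c := by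
  simp [cluster]

lemma crosses_mk {S : Finset V} {x y : V} :
    crosses S s(x, y) ↔ (x ∈ S ∧ y ∉ S) ∨ (y ∈ S ∧ x ∉ S) := by
  constructor
  · rintro ⟨u, v, h, hu, hv⟩
    rcases Sym2.eq_iff.1 h with ⟨rfl, rfl⟩ | ⟨rfl, rfl⟩
    · exact Or.inl ⟨hu, hv⟩
    · exact Or.inr ⟨hu, hv⟩
  · rintro (⟨h1, h2⟩ | ⟨h1, h2⟩)
    · exact ⟨x, y, rfl, h1, h2⟩
    · exact ⟨y, x, Sym2.eq_swap, h1, h2⟩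

lemma crosses_cluster_mk {f : V → V} {c x y : V} :
    crosses (cluster f c) s(x, y) ↔ (c = f x ∨ c = f y) ∧ f x ≠ f y := by
  simp only [crosses_mk, mem_cluster]
  grind

namespace ClusterTree

variable {G : SimpleGraph V} {f : V → V} {r : V} {T : Finset V} {F : Finset (Sym2 V)}

lemma root_mem (h : ClusterTree G f r T F) : r ∈ T := by
  induction h with
  | root => simp
  | grow _ _ _ _ ih => exact mem_insert_of_mem ih

lemma mem_edgeSet (h : ClusterTree G f r T F) : ∀ e ∈ F, e ∈ G.edgeSet := by
  induction h with
  | root => simp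
  | grow _ hxy _ _ ih =>
    intro e he
    rcases mem_insert.1 he with rfl | he
    · exact hxy
    · exact ih e he

lemma label_mem (h : ClusterTree G f r T F) : ∀ e ∈ F, ∀ x ∈ e, f x ∈ T := by
  induction h with
  | root => simp
  | grow _ _ hx _ ih =>
    intro e he z hz
    rcases mem_insert.1 he with rfl | he
    · rcases Sym2.mem_iff.1 hz with rfl | rfl
      · exact mem_insert_of_mem hx
      · exact mem_insert_self _ _
    · exact mem_insert_of_mem (ih e he z hz)

lemma notMem_edges (h : ClusterTree G f r T F) {x y : V} (hy : f y ∉ T) : s(x, y) ∉ F :=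
  fun he => hy (h.label_mem _ he y (Sym2.mem_mk_right x y))

lemma clusterDegree_insert (h : ClusterTree G f r T F) {x y : V} (hx : f x ∈ T)
    (hy : f y ∉ T) (c : V) :
    clusterDegree f (insert s(x, y) F) c =
      clusterDegree f F c + if c = f x ∨ c = f y then 1 else 0 := by
  have hne : f x ≠ f y := fun hxy => hy (hxy ▸ hx)
  unfold clusterDegree
  rw [filter_insert]
  by_cases hc : c = f x ∨ c = f y
  · rw [if_pos (crosses_cluster_mk.2 ⟨hc, hne⟩), if_pos hc, card_insert_of_notMem]
    exact fun hm => h.notMem_edges hy (mem_filter.1 hm).1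
  · rw [if_neg (fun hm => hc (crosses_cluster_mk.1 hm).1), if_neg hc, add_zero]

lemma clusterDegree_of_notMem (h : ClusterTree G f r T F) {c : V} (hc : c ∉ T) :
    clusterDegree f F c = 0 := by
  unfold clusterDegree
  rw [card_eq_zero, filter_eq_empty_iff]
  rintro e he ⟨a, b, rfl, ha, -⟩
  exact hc (mem_cluster.1 ha ▸ h.label_mem _ he a (Sym2.mem_mk_left a b))

lemma one_le_clusterDegree (h : ClusterTree G f r T F) {c : V} (hc : c ∈ T)
    (hcT : c ≠ r ∨ T ≠ {r}) : 1 ≤ clusterDegree f F c := by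
  induction h generalizing c with
  | root => simp_all
  | @grow T F x y h hxy hx hy ih =>
    rw [h.clusterDegree_insert hx hy]
    split_ifs with hcxy
    · omega
    · push Not at hcxy
      have hcT' : c ∈ T := (mem_insert.1 hc).resolve_left hcxy.2
      refine le_add_right (ih hcT' ?_)
      by_contra! hcon
      obtain ⟨rfl, rfl⟩ := hcon
      exact hcxy.1 (mem_singleton.1 hx).symm

lemma sum_clusterDegree (h : ClusterTree G f r T F) :
    ∑ c, clusterDegree f F c + 2 = 2 * T.card := by
  induction h with
  | root => simp [clusterDegree]
  | @grow T F x y h hxy hx hy ih =>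
    have hne : f x ≠ f y := fun hxy => hy (hxy ▸ hx)
    rw [sum_congr rfl fun c _ => h.clusterDegree_insert hx hy c, sum_add_distrib,
      card_insert_of_notMem hy, ← card_filter,
      show (univ.filter fun c => c = f x ∨ c = f y) = {f x, f y} by ext; simp,
      card_pair hne]
    omega

lemma exists_erase (h : ClusterTree G f r T F) {v : V} (hv : v ∈ T) (hvr : v ≠ r)
    (hdeg : clusterDegree f F v ≤ 1) : ∃ F' ⊆ F, ClusterTree G f r (T.erase v) F' := by
  induction h with
  | root => simp_all
  | @grow T F x y h hxy hx hy ih =>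
    rw [h.clusterDegree_insert hx hy] at hdeg
    by_cases hvy : v = f y
    · subst hvy
      exact ⟨F, subset_insert _ _, by rwa [erase_insert hy]⟩
    have hvT : v ∈ T := (mem_insert.1 hv).resolve_left hvy
    have hpos := h.one_le_clusterDegree hvT (Or.inl hvr)
    have hvx : v ≠ f x := by
      rintro rfl
      simp at hdeg
      omega
    rw [if_neg (by simp [hvx, hvy]), add_zero] at hdeg
    obtain ⟨F', hF', h'⟩ := ih hvT hdeg
    refine ⟨insert s(x, y) F', insert_subset_insert _ hF', ?_⟩
    rw [erase_insert_of_ne (Ne.symm hvy)]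
    exact h'.grow hxy (mem_erase.2 ⟨hvx.symm, hx⟩) fun hm => hy (mem_of_mem_erase hm)

/-- A tree of at least two clusters without inactive non-root leaves has few edge ends at
active clusters. -/
lemma sum_clusterDegree_active_le (h : ClusterTree G f r T F) (hT : T ≠ {r}) {A : Finset V}
    (hrA : r ∉ A) (hdeg : ∀ c ∈ T, c ∉ A → c ≠ r → 2 ≤ clusterDegree f F c) :
    ∑ c ∈ A, clusterDegree f F c + (A \ T).card + 1 ≤ 2 * A.card := by
  have hr := h.one_le_clusterDegree h.root_mem (Or.inr hT)
  have hsum := h.sum_clusterDegree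
  have hsplit : ∑ c ∈ A, clusterDegree f F c + ∑ c ∈ Aᶜ, clusterDegree f F c
      = ∑ c, clusterDegree f F c := sum_add_sum_compl A _
  have hrest : clusterDegree f F r + ∑ c ∈ (T \ A).erase r, clusterDegree f F c
      ≤ ∑ c ∈ Aᶜ, clusterDegree f F c := by
    rw [add_sum_erase _ _ (mem_sdiff.2 ⟨h.root_mem, hrA⟩)]
    exact sum_le_sum_of_subset fun c hc => mem_compl.2 (mem_sdiff.1 hc).2
  have htwo : ((T \ A).erase r).card * 2 ≤ ∑ c ∈ (T \ A).erase r, clusterDegree f F c := by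
    rw [← smul_eq_mul]
    refine card_nsmul_le_sum _ _ _ fun c hc => ?_
    simp only [mem_erase, mem_sdiff] at hc
    exact hdeg c hc.2.1 hc.2.2 hc.1
  have hcard : ((T \ A).erase r).card + 1 = (T \ A).card :=
    card_erase_add_one (mem_sdiff.2 ⟨h.root_mem, hrA⟩)
  have h1 := card_sdiff_add_card_inter T A
  have h2 := card_sdiff_add_card_inter A T
  rw [inter_comm] at h2
  omega

/-- Un-contracting an edge of weight zero turns a cluster tree of the contracted instance into
one of the original instance with the same edge weight. -/
lemma exists_uncontract {w : Sym2 V → ℝ} {a b : V} (hab : G.Adj a b) (hne : f a ≠ f b)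
    (hb : f b ≠ r) (hw : w s(a, b) = 0) {π : V → V}
    (hπ : π = fun c => if c = f b then f a else c)
    (h : ClusterTree G (π ∘ f) r T F) :
    ∃ F', ClusterTree G f r (univ.filter fun c => π c ∈ T) F' ∧
      ∑ e ∈ F', w e = ∑ e ∈ F, w e := by
  have hw' : w s(b, a) = 0 := by rwa [Sym2.eq_swap]
  induction h with
  | root =>
    by_cases ha : f a = r
    · refine ⟨insert s(a, b) ∅, ?_, ?_⟩
      · convert grow (root (G := G) (f := f) (r := r)) hab (by simp [ha]) (by simp [hb]) using 1
        ext c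
        simp only [hπ, mem_filter, mem_univ, true_and, mem_singleton, mem_insert]
        grind
      · simp [hw]
    · refine ⟨∅, ?_, rfl⟩
      convert root (G := G) (f := f) (r := r) using 1
      ext c
      simp only [hπ, mem_filter, mem_univ, true_and, mem_singleton]
      grind
  | @grow T F x y h hxy hx hy ih =>
    obtain ⟨F', hF', hsum⟩ := ih
    have hyF : s(x, y) ∉ F := h.notMem_edges hy
    have hx' : f x ∈ univ.filter fun c => π c ∈ T := by simpa using hx
    have hy' : f y ∉ univ.filter fun c => π c ∈ T := by simpa using hy
    have hg := hF'.grow hxy hx' hy'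
    have hyF' : s(x, y) ∉ F' := hF'.notMem_edges hy'
    have hs : ∑ e ∈ insert s(x, y) F', w e = ∑ e ∈ insert s(x, y) F, w e := by
      rw [sum_insert hyF, sum_insert hyF', hsum]
    by_cases hya : f y = f a
    · have hbn : f b ∉ insert (f y) (univ.filter fun c => π c ∈ T) := by
        simp only [hπ, mem_filter, mem_univ, true_and, mem_insert, Function.comp] at hy ⊢
        grind
      have hg' := hg.grow hab (by simp [hya]) hbn
      refine ⟨insert s(a, b) (insert s(x, y) F'), ?_, ?_⟩
      · convert hg' using 1
        ext c
        simp only [hπ, mem_filter, mem_univ, true_and, mem_insert, Function.comp] at hy ⊢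
        grind
      · rw [sum_insert (hg.notMem_edges hbn), hw, zero_add, hs]
    by_cases hyb : f y = f b
    · have han : f a ∉ insert (f y) (univ.filter fun c => π c ∈ T) := by
        simp only [hπ, mem_filter, mem_univ, true_and, mem_insert, Function.comp] at hy ⊢
        grind
      have hg' := hg.grow hab.symm (by simp [hyb]) han
      refine ⟨insert s(b, a) (insert s(x, y) F'), ?_, ?_⟩
      · convert hg' using 1
        ext c
        simp only [hπ, mem_filter, mem_univ, true_and, mem_insert, Function.comp] at hy ⊢
        grind
      · rw [sum_insert (hg.notMem_edges han), hw', zero_add, hs]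
    · refine ⟨_, ?_, hs⟩
      convert hg using 1
      ext c
      simp only [hπ, mem_filter, mem_univ, true_and, mem_insert, Function.comp] at hy ⊢
      grind

lemma isRootedSubtree (h : ClusterTree G id r T F) : IsRootedSubtree G r T F := by
  refine ⟨h.root_mem, h.mem_edgeSet, h.label_mem, ?_⟩
  induction h with
  | root => simp
  | @grow T F x y h hxy hx hy ih =>
    obtain ⟨hreach, hacyc⟩ := ih
    simp only [id] at hx hy ⊢
    have heq : SimpleGraph.fromEdgeSet ((insert s(x, y) F : Finset (Sym2 V)) : Set (Sym2 V)) =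
        SimpleGraph.fromEdgeSet (F : Set (Sym2 V)) ⊔ SimpleGraph.edge x y := by
      rw [SimpleGraph.edge, ← SimpleGraph.fromEdgeSet_union, coe_insert, Set.union_singleton]
    rw [heq]
    have hle : SimpleGraph.fromEdgeSet (F : Set (Sym2 V)) ≤
        SimpleGraph.fromEdgeSet (F : Set (Sym2 V)) ⊔ SimpleGraph.edge x y := le_sup_left
    constructor
    · have hxy' : (SimpleGraph.fromEdgeSet (F : Set (Sym2 V)) ⊔ SimpleGraph.edge x y).Reachable
          x y := SimpleGraph.Adj.reachable (by simp [SimpleGraph.edge_adj, hxy.ne])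
      have key : ∀ u ∈ insert y T,
          (SimpleGraph.fromEdgeSet (F : Set (Sym2 V)) ⊔ SimpleGraph.edge x y).Reachable x u := by
        intro u hu
        rcases mem_insert.1 hu with rfl | hu
        · exact hxy'
        · exact (hreach x hx u hu).mono hle
      exact fun u hu v hv => (key u hu).symm.trans (key v hv)
    · refine SimpleGraph.IsAcyclic.sup_edge_of_not_reachable ?_ hacyc
      intro hxy'
      obtain ⟨p⟩ := hxy'.symm
      cases p with
      | nil => exact hxy.ne rfl
      | @cons _ z _ hz _ =>
        have hm : s(y, z) ∈ F := by simpa using ((SimpleGraph.fromEdgeSet_adj _).1 hz).1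
        exact hy (h.label_mem _ hm y (Sym2.mem_mk_left y z))

end ClusterTree

/-- Inactive non-root leaves can be removed from a cluster tree without raising its cost. -/
lemma ClusterTree.exists_pruned {G : SimpleGraph V} {f : V → V} {r : V} {T : Finset V}
    {F : Finset (Sym2 V)} {w : Sym2 V → ℝ} {q : V → ℝ} {A : Finset V}
    (h : ClusterTree G f r T F) (hw : ∀ e ∈ G.edgeSet, 0 ≤ w e)
    (hq : ∀ c, c ≠ r → c ∉ A → q c = 0) :
    ∃ T' F', ClusterTree G f r T' F' ∧
      ∑ e ∈ F', w e + ∑ c ∈ univ \ T', q c ≤ ∑ e ∈ F, w e + ∑ c ∈ univ \ T, q c ∧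
      ∀ c ∈ T', c ∉ A → c ≠ r → 2 ≤ clusterDegree f F' c := by
  induction hk : T.card generalizing T F with
  | zero => exact absurd h.root_mem (by simp [card_eq_zero.1 hk])
  | succ k ih =>
    by_cases hall : ∀ c ∈ T, c ∉ A → c ≠ r → 2 ≤ clusterDegree f F c
    · exact ⟨T, F, h, le_rfl, hall⟩
    push Not at hall
    obtain ⟨c, hcT, hcA, hcr, hdeg⟩ := hall
    obtain ⟨F', hF', h'⟩ := h.exists_erase hcT hcr (by omega)
    obtain ⟨T₂, F₂, h₂, hcost, hdeg₂⟩ := ih h' (by rw [card_erase_of_mem hcT]; omega)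
    refine ⟨T₂, F₂, h₂, hcost.trans (add_le_add ?_ (le_of_eq ?_)), hdeg₂⟩
    · exact sum_le_sum_of_subset_of_nonneg hF' fun e he _ => hw e (h.mem_edgeSet e he)
    · rw [sdiff_erase (mem_univ c), sum_insert (by simp [hcT]), hq c hcr hcA, zero_add]

lemma sum_edgeLoad (f : V → V) (A : Finset V) (F : Finset (Sym2 V)) :
    ∑ e ∈ F, edgeLoad f A e = ∑ c ∈ A, clusterDegree f F c := by
  simp only [edgeLoad, clusterDegree, card_filter]
  exact sum_comm

/-- Raising the dual variables of the clusters labelled by `A` raises the dual value of a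
family of sets by the number of such clusters in the family. -/
lemma sum_raise_dual {f : V → V} {r : V} {A : Finset V}
    (hA : ∀ c ∈ A, cluster f c ∈ dualSets r) (y : Finset V → ℝ) (ε : ℝ)
    (P : Finset V → Prop) [DecidablePred P] :
    ∑ S ∈ (dualSets r).filter P, (y S + ∑ c ∈ A, if cluster f c = S then ε else 0) =
      ∑ S ∈ (dualSets r).filter P, y S + ∑ c ∈ A, if P (cluster f c) then ε else 0 := by
  rw [sum_add_distrib, sum_comm]
  congr 1
  refine sum_congr rfl fun c hc => ?_
  rw [sum_ite_eq]
  simp [hA c hc]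

namespace HasCertificate

variable {G : SimpleGraph V} {r : V} {ρ : ℝ} {f : V → V} {w : Sym2 V → ℝ} {q : V → ℝ}

/-- Growing the dual variables of all active clusters by `ε`. -/
lemma of_reduced {A : Finset V} {ε : ℝ} (hρ : 1 ≤ ρ) (hρA : 2 * (A.card : ℝ) - 1 ≤ ρ * A.card)
    (hr : f r = r) (hA : ∀ c ∈ A, c ≠ r ∧ f c = c) (hε : 0 ≤ ε)
    (hq : ∀ c, c ≠ r → c ∉ A → q c = 0)
    (hw : ∀ e ∈ G.edgeSet, 0 ≤ w e - ε * edgeLoad f A e)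
    (h : HasCertificate G r ρ f (fun e => w e - ε * edgeLoad f A e)
      (fun c => q c - if c ∈ A then ε else 0)) :
    HasCertificate G r ρ f w q := by
  obtain ⟨T₀, F₀, y, hT₀, ⟨hy, hedge, hpen⟩, hsat, hcost₀⟩ := h
  obtain ⟨T, F, hT, hcost, hdeg⟩ := hT₀.exists_pruned (A := A)
    (q := fun c => q c - if c ∈ A then ε else 0) hw
    (fun c hcr hcA => by simp [hq c hcr hcA, hcA])
  replace hcost := hcost.trans hcost₀
  have hrA : r ∉ A := fun h => (hA r h).1 rfl
  have hmem : ∀ c ∈ A, cluster f c ∈ dualSets r := fun c hc =>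
    mem_dualSets.2 ⟨fun h => (hA c hc).1 ((mem_cluster.1 h).symm.trans hr),
      c, mem_cluster.2 (hA c hc).2⟩
  refine ⟨T, F, fun S => y S + ∑ c ∈ A, if cluster f c = S then ε else 0, hT,
    ⟨fun S hS => ?_, fun e he => ?_, fun U hU => ?_⟩, ?_, ?_⟩
  · exact add_nonneg (hy S hS) (sum_nonneg fun c _ => by split_ifs <;> simp [hε])
  · rw [sum_raise_dual hmem, ← sum_filter, sum_const, nsmul_eq_mul]
    have := hedge e he
    simp only [edgeLoad] at this
    linarith
  · rw [sum_raise_dual hmem]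
    have h1 := hpen U hU
    rw [sum_sub_distrib, ← sum_filter] at h1
    have h2 : ∑ c ∈ A, (if cluster f c ⊆ U then ε else 0) ≤ ∑ c ∈ U.filter (· ∈ A), ε := by
      rw [← sum_filter]
      refine sum_le_sum_of_subset_of_nonneg (fun c hc => ?_) fun _ _ _ => hε
      obtain ⟨hcA, hcU⟩ := mem_filter.1 hc
      exact mem_filter.2 ⟨hcU (mem_cluster.2 (hA c hcA).2), hcA⟩
    linarith
  · intro S hS hne a b hab ha
    by_cases hyS : y S = 0
    · simp only [hyS, zero_add] at hne
      obtain ⟨c, -, hc⟩ := exists_ne_zero_of_sum_ne_zero hne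
      have hcS : cluster f c = S := by
        by_contra hcon
        simp [hcon] at hc
      rw [← hcS, mem_cluster] at ha ⊢
      exact hab.symm.trans ha
    · exact hsat S hS hyS a b hab ha
  · have hdual := sum_raise_dual hmem y ε (fun _ => True)
    simp only [filter_true, if_true, sum_const, nsmul_eq_mul] at hdual
    rw [hdual]
    have hload : ∑ e ∈ F, (edgeLoad f A e : ℝ) = ((∑ c ∈ A, clusterDegree f F c : ℕ) : ℝ) := by
      rw [← sum_edgeLoad]
      push_cast
      rfl
    have hpaid : ∑ c ∈ univ \ T, (if c ∈ A then ε else 0) = (A \ T).card * ε := by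
      rw [← sum_filter, sum_const, nsmul_eq_mul,
        show (univ \ T).filter (· ∈ A) = A \ T by ext; simp [and_comm]]
    rw [sum_sub_distrib, sum_sub_distrib, ← mul_sum, hload, hpaid] at hcost
    have hcount : ((∑ c ∈ A, clusterDegree f F c : ℕ) : ℝ) + (A \ T).card ≤ ρ * A.card := by
      by_cases hTr : T = {r}
      · have hzero : ∑ c ∈ A, clusterDegree f F c = 0 := sum_eq_zero fun c hc =>
          hT.clusterDegree_of_notMem (by simp [hTr, (hA c hc).1])
        have hle : ((A \ T).card : ℝ) ≤ A.card := by exact_mod_cast card_le_card sdiff_subset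
        have hnn : (0 : ℝ) ≤ A.card := by positivity
        rw [hzero]
        push_cast
        nlinarith
      · have hle : ((∑ c ∈ A, clusterDegree f F c + (A \ T).card + 1 : ℕ) : ℝ) ≤
            ((2 * A.card : ℕ) : ℝ) :=
          Nat.cast_le.2 (hT.sum_clusterDegree_active_le hTr hrA hdeg)
        rw [Nat.cast_add, Nat.cast_add, Nat.cast_mul, Nat.cast_one, Nat.cast_ofNat] at hle
        linarith
    have := mul_le_mul_of_nonneg_left hcount hε
    linarith

/-- Contracting an edge of weight zero. -/
lemma of_contracted {a b : V} (hf : ∀ x, f (f x) = f x) (hab : G.Adj a b)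
    (hne : f a ≠ f b) (hb : f b ≠ r) (hw : w s(a, b) = 0) (hq : ∀ c, 0 ≤ q c) {π : V → V}
    (hπ : π = fun c => if c = f b then f a else c)
    (h : HasCertificate G r ρ (π ∘ f) w fun c => ∑ d ∈ univ.filter fun d => π d = c, q d) :
    HasCertificate G r ρ f w q := by
  obtain ⟨T', F', y, hT', ⟨hy, hedge, hpen⟩, hsat, hcost⟩ := h
  obtain ⟨F, hF, hsum⟩ := hT'.exists_uncontract hab hne hb hw hπ
  have hfiber : ∀ U : Finset V, ∑ c ∈ U, ∑ d ∈ univ.filter (fun d => π d = c), q d =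
      ∑ d ∈ univ.filter (fun d => π d ∈ U), q d := by
    intro U
    rw [← sum_fiberwise_of_maps_to (s := univ.filter fun d => π d ∈ U) (t := U) (g := π)
      fun d hd => (mem_filter.1 hd).2]
    refine sum_congr rfl fun c hc => sum_congr ?_ fun _ _ => rfl
    ext d
    simp only [mem_filter, mem_univ, true_and]
    grind
  have hclosed : ∀ S ∈ dualSets r, y S ≠ 0 → ∀ d, π d ∈ S → d ∈ S := by
    intro S hS hyS d hd
    by_cases hdb : d = f b
    · refine hsat S hS hyS (π d) d ?_ hd
      simp [hπ, hdb, hf]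
    · simpa [hπ, hdb] using hd
  refine ⟨_, F, y, hF, ⟨hy, hedge, fun U hU => ?_⟩, fun S hS hyS x z hxz =>
    hsat S hS hyS x z (congrArg π hxz), ?_⟩
  · set U' : Finset V := univ.filter fun c => ∀ d, π d = c → d ∈ U with hU'
    have hπr : π r = r := by simp [hπ, hb.symm]
    have hU'mem : U' ∈ dualSets r := by
      refine mem_dualSets.2 ⟨fun h => (mem_dualSets.1 hU).1 ((mem_filter.1 h).2 r hπr), f b, ?_⟩
      simp only [hU', hπ, mem_filter, mem_univ, true_and]
      grind
    have hpen' := hpen U' hU'mem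
    rw [hfiber] at hpen'
    calc ∑ S ∈ (dualSets r).filter (fun S => S ⊆ U), y S
        ≤ ∑ S ∈ (dualSets r).filter (fun S => S ⊆ U'), y S := by
          rw [sum_filter, sum_filter]
          refine sum_le_sum fun S hS => ?_
          by_cases hyS : y S = 0
          · simp [hyS]
          by_cases hSU : S ⊆ U
          · rw [if_pos hSU, if_pos]
            intro c hc
            exact mem_filter.2 ⟨mem_univ _, fun d hd =>
              hSU (hclosed S hS hyS d (hd ▸ hc))⟩
          · rw [if_neg hSU]
            split_ifs
            exacts [hy S hS, le_rfl]
      _ ≤ ∑ d ∈ univ.filter (fun d => π d ∈ U'), q d := hpen'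
      _ ≤ ∑ d ∈ U, q d := by
          refine sum_le_sum_of_subset_of_nonneg (fun d hd => ?_) fun d _ _ => hq d
          exact (mem_filter.1 (mem_filter.1 hd).2).2 d rfl
  · rw [hfiber] at hcost
    rw [hsum]
    convert hcost using 4
    ext d
    simp

end HasCertificate

/-- The largest uniform dual growth step: some active prize or some edge becomes tight. -/
lemma exists_max_growth {G : SimpleGraph V} {w : Sym2 V → ℝ} {q : V → ℝ} {f : V → V}
    {A : Finset V} (hA : A.Nonempty) (hw : ∀ e ∈ G.edgeSet, 0 ≤ w e)
    (hq : ∀ c ∈ A, 0 ≤ q c) :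
    ∃ ε : ℝ, 0 ≤ ε ∧ (∀ c ∈ A, ε ≤ q c) ∧ (∀ e ∈ G.edgeSet, ε * edgeLoad f A e ≤ w e) ∧
      ((∃ c ∈ A, q c = ε) ∨ ∃ e ∈ G.edgeSet, 0 < edgeLoad f A e ∧ w e = ε * edgeLoad f A e) := by
  obtain ⟨c, hcA, hc⟩ := exists_min_image A q hA
  set B : Finset (Sym2 V) := univ.filter fun e => e ∈ G.edgeSet ∧ 0 < edgeLoad f A e with hB
  by_cases hslack : ∀ e ∈ B, q c * edgeLoad f A e ≤ w e
  · refine ⟨q c, hq c hcA, hc, fun e he => ?_, Or.inl ⟨c, hcA, rfl⟩⟩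
    rcases Nat.eq_zero_or_pos (edgeLoad f A e) with h0 | hpos
    · simpa [h0] using hw e he
    · exact hslack e (by simp [hB, he, hpos])
  push Not at hslack
  obtain ⟨e₁, he₁, hlt⟩ := hslack
  obtain ⟨e, heB, he⟩ := exists_min_image B (fun e => w e / edgeLoad f A e) ⟨e₁, he₁⟩
  have hBmem : ∀ e ∈ B, e ∈ G.edgeSet ∧ 0 < edgeLoad f A e := by simp [hB]
  have hBpos : ∀ e ∈ B, (0 : ℝ) < edgeLoad f A e := fun e he => Nat.cast_pos.2 (hBmem e he).2
  refine ⟨w e / edgeLoad f A e, div_nonneg (hw e (hBmem e heB).1) (hBpos e heB).le,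
    fun d hd => ?_, fun e' he' => ?_, Or.inr ⟨e, (hBmem e heB).1, (hBmem e heB).2, ?_⟩⟩
  · exact (he e₁ he₁).trans (((div_le_iff₀ (hBpos e₁ he₁)).2 hlt.le).trans (hc d hd))
  · rcases Nat.eq_zero_or_pos (edgeLoad f A e') with h0 | hpos
    · simpa [h0] using hw e' he'
    · have he'B : e' ∈ B := by simp [hB, he', hpos]
      exact (le_div_iff₀ (hBpos e' he'B)).1 (he e' he'B)
  · exact (div_mul_cancel₀ _ (hBpos e heB).ne').symm

/-- Every clustered instance has a certificate for any ratio `ρ ≥ 1` that is at least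
`2 - 1 / k` for all possible numbers `k` of active clusters. -/
theorem hasCertificate {G : SimpleGraph V} {r : V} {ρ : ℝ} (hρ : 1 ≤ ρ)
    (hρA : ∀ A : Finset V, r ∉ A → 2 * (A.card : ℝ) - 1 ≤ ρ * A.card)
    {f : V → V} {w : Sym2 V → ℝ} {q : V → ℝ} (hf : ∀ x, f (f x) = f x) (hr : f r = r)
    (hw : ∀ e ∈ G.edgeSet, 0 ≤ w e) (hq : ∀ c, 0 ≤ q c)
    (hfix : ∀ c, c ≠ r → 0 < q c → f c = c) : HasCertificate G r ρ f w q := by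
  induction hk : 2 * (univ.filter fun c => f c = c).card + (activeLabels r q).card
    using Nat.strong_induction_on generalizing f w q with
  | _ k ih =>
  set A := activeLabels r q with hAdef
  have hAmem : ∀ c, c ∈ A ↔ c ≠ r ∧ 0 < q c := by simp [hAdef, activeLabels]
  have hrA : r ∉ A := by simp [hAmem]
  have hqA : ∀ c, c ≠ r → c ∉ A → q c = 0 := fun c hcr hcA =>
    le_antisymm (not_lt.1 fun h => hcA ((hAmem c).2 ⟨hcr, h⟩)) (hq c)
  rcases A.eq_empty_or_nonempty with hA | hA
  · refine ⟨{r}, ∅, 0, .root, ⟨by simp, by simpa using hw, fun U _ => ?_⟩, by simp, ?_⟩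
    · simpa using sum_nonneg fun c _ => hq c
    · have : ∑ c ∈ univ \ {r}, q c = 0 := sum_eq_zero fun c hc =>
        hqA c (by simpa using hc) (by simp [hA])
      simp [this]
  obtain ⟨ε, hε, hεq, hεw, htight⟩ := exists_max_growth (f := f) hA hw fun c _ => hq c
  have hw' : ∀ e ∈ G.edgeSet, 0 ≤ w e - ε * edgeLoad f A e := fun e he =>
    sub_nonneg.2 (hεw e he)
  refine HasCertificate.of_reduced hρ (hρA A hrA) hr
    (fun c hc => ⟨((hAmem c).1 hc).1, hfix c ((hAmem c).1 hc).1 ((hAmem c).1 hc).2⟩) hε hqA hw' ?_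
  set w' : Sym2 V → ℝ := fun e => w e - ε * edgeLoad f A e with hw'def
  set q' : V → ℝ := fun c => q c - if c ∈ A then ε else 0 with hq'def
  have hq' : ∀ c, 0 ≤ q' c := by
    intro c
    simp only [hq'def]
    split_ifs with hc
    · exact sub_nonneg.2 (hεq c hc)
    · simpa using hq c
  have hq'le : ∀ c, q' c ≤ q c := by
    intro c
    simp only [hq'def]
    split_ifs <;> linarith
  have hfix' : ∀ c, c ≠ r → 0 < q' c → f c = c := fun c hcr hc =>
    hfix c hcr (hc.trans_le (hq'le c))
  have hsub : activeLabels r q' ⊆ A := by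
    intro c hc
    simp only [activeLabels, mem_filter, mem_univ, true_and] at hc
    exact (hAmem c).2 ⟨hc.1, hc.2.trans_le (hq'le c)⟩
  rcases htight with ⟨c, hcA, hc⟩ | ⟨e, he, hload, hwe⟩
  · refine ih _ ?_ hf hr hw' hq' hfix' rfl
    have hlt : (activeLabels r q').card < A.card := by
      refine card_lt_card ⟨hsub, fun h => ?_⟩
      have := (mem_filter.1 (h hcA)).2.2
      simp [hq'def, hcA, hc] at this
    omega
  · obtain ⟨a, b, hab, hne, hb, hwab⟩ : ∃ a b, G.Adj a b ∧ f a ≠ f b ∧ f b ≠ r ∧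
        w' s(a, b) = 0 := by
      have hw0 : w' e = 0 := by simp [hw'def, hwe]
      obtain ⟨c, hc⟩ := card_pos.1 hload
      have hcross := (mem_filter.1 hc).2
      induction e using Sym2.ind with
      | _ a b =>
      have hne := (crosses_cluster_mk.1 hcross).2
      by_cases hb : f b = r
      · exact ⟨b, a, SimpleGraph.Adj.symm he, hne.symm, fun ha => hne (ha.trans hb.symm),
          by rwa [Sym2.eq_swap]⟩
      · exact ⟨a, b, he, hne, hb, hw0⟩
    obtain ⟨π, hπ⟩ : ∃ π : V → V, π = fun c => if c = f b then f a else c := ⟨_, rfl⟩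
    refine HasCertificate.of_contracted hf hab hne hb hwab hq' hπ ?_
    have hπr : π r = r := by simp [hπ, hb.symm]
    have hfixed : (univ.filter fun c => (π ∘ f) c = c) ⊆
        (univ.filter fun c => f c = c).erase (f b) := by
      intro c hc
      simp only [hπ, Function.comp, mem_filter, mem_univ, true_and, mem_erase] at hc ⊢
      grind
    have hactive : activeLabels r (fun c => ∑ d ∈ univ.filter (fun d => π d = c), q' d) ⊆
        insert (f a) A := by
      intro c hc
      simp only [activeLabels, mem_filter, mem_univ, true_and] at hc
      obtain ⟨d, hd, hd0⟩ := exists_ne_zero_of_sum_ne_zero hc.2.ne'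
      have hdc := (mem_filter.1 hd).2
      rw [mem_insert]
      by_cases hdb : d = f b
      · left
        simpa [hπ, hdb] using hdc.symm
      · right
        have hdc' : d = c := by simpa [hπ, hdb] using hdc
        subst hdc'
        exact hsub (mem_filter.2 ⟨mem_univ _, hc.1, lt_of_le_of_ne (hq' d) hd0.symm⟩)
    refine ih _ ?_ (fun x => ?_) (by simp [hr, hπr]) hw' (fun c => sum_nonneg fun d _ => hq' d)
      (fun c hcr hc => ?_) rfl
    · have h1 := card_le_card hfixed
      rw [card_erase_of_mem (by simp [hf])] at h1
      have h2 := (card_le_card hactive).trans (card_insert_le _ _)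
      have h3 : 0 < (univ.filter fun c => f c = c).card := card_pos.2 ⟨f b, by simp [hf]⟩
      omega
    · simp only [hπ, Function.comp]
      grind
    · obtain ⟨d, hd, hd0⟩ := exists_ne_zero_of_sum_ne_zero hc.ne'
      have hdc := (mem_filter.1 hd).2
      have hdr : d ≠ r := by
        rintro rfl
        exact hcr (hdc.symm.trans hπr)
      have hfd := hfix' d hdr (lt_of_le_of_ne (hq' d) hd0.symm)
      simp only [hπ, Function.comp] at hdc ⊢
      grind

/-- **Goemans–Williamson guarantee with dual certificate (existence form).** For every
PCST instance with `n = |V| ≥ 2` there exist a subtree `(V', E')` of `G` containing the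
root `r` and a dual feasible solution `y` whose total dual value certifies the
`(2 - 1/(n-1))` approximation bound on the GW-value of the subtree. -/
theorem gw_guarantee_with_dual_certificate
    (G : SimpleGraph V) [DecidableRel G.Adj]
    (w : Sym2 V → ℝ) (p : V → ℝ) (r : V)
    (hG : G.Connected)
    (hw : ∀ e ∈ G.edgeSet, 0 ≤ w e) (hp : ∀ v, 0 ≤ p v)
    (hn : 2 ≤ Fintype.card V) :
    ∃ (V' : Finset V) (E' : Finset (Sym2 V)) (y : Finset V → ℝ),
      IsRootedSubtree G r V' E' ∧ DualFeasible G w p r y ∧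
      ∑ e ∈ E', w e + ∑ v ∈ Finset.univ \ V', p v ≤
        (2 - 1 / ((Fintype.card V : ℝ) - 1)) * ∑ S ∈ dualSets r, y S := by
  have hn' : (2 : ℝ) ≤ Fintype.card V := by exact_mod_cast hn
  have hpos : (0 : ℝ) < (Fintype.card V : ℝ) - 1 := by linarith
  have hinv : 1 / ((Fintype.card V : ℝ) - 1) ≤ 1 := by
    rw [div_le_one hpos]
    linarith
  have hcert : HasCertificate G r (2 - 1 / ((Fintype.card V : ℝ) - 1)) id w p := by
    refine hasCertificate (by linarith) (fun A hA => ?_) (fun x => rfl) rfl hw hp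
      fun c _ _ => rfl
    have hcard : (A.card : ℝ) ≤ (Fintype.card V : ℝ) - 1 := by
      have h := card_le_card (subset_erase.2 ⟨subset_univ A, hA⟩)
      rw [card_erase_of_mem (mem_univ r), card_univ] at h
      have h' : A.card + 1 ≤ Fintype.card V := by omega
      have h'' : (A.card : ℝ) + 1 ≤ Fintype.card V := by exact_mod_cast h'
      linarith
    have hdiv : 1 / ((Fintype.card V : ℝ) - 1) * A.card ≤ 1 := by
      rw [one_div_mul_eq_div, div_le_one hpos]
      exact hcard
    linarith
  obtain ⟨T, F, y, hT, hy, -, hcost⟩ := hcert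
  exact ⟨T, F, y, hT.isRootedSubtree, hy, hcost⟩
end
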